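/- Let (G,+) be a finite abelian group of order v = 2m+1 and let {B_1, B_2} be a difference family in G with parameters (2m+1, m, m−1) such that B_1 is skew. Let M_1 be the type-1 matrix of B_1 and M_2 the type-2 matrix of B_2 (with respect to a fixed ordering of G). Then the (2v+2)×(2v+2) block matrix H = [[1, 1, 1_vᵀ, 1_vᵀ], [−1, 1, 1_vᵀ, −1_vᵀ], [−1_v, −1_v, −M_1, −M_2], [−1_v, 1_v, M_2, −M_1]], where 1_v is the all-ones column vector of length v, is a skew Hadamard matrix of order 4(m+1). -/

import Mathlib

open Finset Matrix
open scoped Classical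

/-- The type-1 matrix of a subset `X` of a finite abelian group `G`:
the `(i,j)` entry is `1` if `j - i ∈ X` and `-1` otherwise. -/
noncomputable def type1Matrix (G : Type) [AddCommGroup G] [Fintype G]
    (X : Finset G) : Matrix G G ℝ :=
  fun i j => if j - i ∈ X then 1 else -1

/-- The type-2 matrix of a subset `X` of a finite abelian group `G`:
the `(i,j)` entry is `1` if `j + i ∈ X` and `-1` otherwise. -/
noncomputable def type2Matrix (G : Type) [AddCommGroup G] [Fintype G]
    (X : Finset G) : Matrix G G ℝ :=
  fun i j => if j + i ∈ X then 1 else -1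

/-- The Wallis–Street–Wallis array
`[[1, 1, 1ᵀ, 1ᵀ], [-1, 1, 1ᵀ, -1ᵀ], [-1, -1, -M₁, -M₂], [-1, 1, M₂, -M₁]]`. -/
noncomputable def H2 (G : Type) [AddCommGroup G] [Fintype G]
    (B₁ B₂ : Finset G) : Matrix (Fin 2 ⊕ (G ⊕ G)) (Fin 2 ⊕ (G ⊕ G)) ℝ :=
  Matrix.fromBlocks
    !![1, 1; -1, 1]
    (fun i x => Sum.elim (fun _ : G => (1 : ℝ))
      (fun _ : G => if i = 0 then 1 else -1) x)
    (fun x j => Sum.elim (fun _ : G => (-1 : ℝ))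
      (fun _ : G => if j = 0 then -1 else 1) x)
    (Matrix.fromBlocks
      (-(type1Matrix G B₁)) (-(type2Matrix G B₂))
      (type2Matrix G B₂) (-(type1Matrix G B₁)))

/-- The `±1`-valued indicator of a finite set. -/
noncomputable def signInd {G : Type} (X : Finset G) (x : G) : ℝ :=
  if x ∈ X then 1 else -1

theorem type1Matrix_apply {G : Type} [AddCommGroup G] [Fintype G] (X : Finset G) (i j : G) :
    type1Matrix G X i j = signInd X (j - i) := by
  unfold type1Matrix signInd
  congr

theorem type2Matrix_apply {G : Type} [AddCommGroup G] [Fintype G] (X : Finset G) (i j : G) :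
    type2Matrix G X i j = signInd X (j + i) := by
  unfold type2Matrix signInd
  congr

@[simp]
theorem H2_inl_inl {G : Type} [AddCommGroup G] [Fintype G] (B₁ B₂ : Finset G)
    (i j : Fin 2) :
    H2 G B₁ B₂ (.inl i) (.inl j) = !![1, 1; -1, 1] i j :=
  rfl

@[simp]
theorem H2_inl_inr_inl {G : Type} [AddCommGroup G] [Fintype G] (B₁ B₂ : Finset G)
    (i : Fin 2) (j : G) :
    H2 G B₁ B₂ (.inl i) (.inr (.inl j)) = 1 :=
  rfl

@[simp]
theorem H2_inl_inr_inr {G : Type} [AddCommGroup G] [Fintype G] (B₁ B₂ : Finset G)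
    (i : Fin 2) (j : G) :
    H2 G B₁ B₂ (.inl i) (.inr (.inr j)) = if i = 0 then 1 else -1 := by
  fin_cases i <;> rfl

@[simp]
theorem H2_inr_inl_inl {G : Type} [AddCommGroup G] [Fintype G] (B₁ B₂ : Finset G)
    (i : G) (j : Fin 2) :
    H2 G B₁ B₂ (.inr (.inl i)) (.inl j) = -1 :=
  rfl

@[simp]
theorem H2_inr_inl_inr_inl {G : Type} [AddCommGroup G] [Fintype G] (B₁ B₂ : Finset G)
    (i j : G) :
    H2 G B₁ B₂ (.inr (.inl i)) (.inr (.inl j)) = -signInd B₁ (j - i) :=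
  congrArg Neg.neg (type1Matrix_apply _ i j)

@[simp]
theorem H2_inr_inl_inr_inr {G : Type} [AddCommGroup G] [Fintype G] (B₁ B₂ : Finset G)
    (i j : G) :
    H2 G B₁ B₂ (.inr (.inl i)) (.inr (.inr j)) = -signInd B₂ (j + i) :=
  congrArg Neg.neg (type2Matrix_apply _ i j)

@[simp]
theorem H2_inr_inr_inl {G : Type} [AddCommGroup G] [Fintype G] (B₁ B₂ : Finset G)
    (i : G) (j : Fin 2) :
    H2 G B₁ B₂ (.inr (.inr i)) (.inl j) = if j = 0 then -1 else 1 := by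
  fin_cases j <;> rfl

@[simp]
theorem H2_inr_inr_inr_inl {G : Type} [AddCommGroup G] [Fintype G] (B₁ B₂ : Finset G)
    (i j : G) :
    H2 G B₁ B₂ (.inr (.inr i)) (.inr (.inl j)) = signInd B₂ (j + i) :=
  type2Matrix_apply _ i j

@[simp]
theorem H2_inr_inr_inr_inr {G : Type} [AddCommGroup G] [Fintype G] (B₁ B₂ : Finset G)
    (i j : G) :
    H2 G B₁ B₂ (.inr (.inr i)) (.inr (.inr j)) = -signInd B₁ (j - i) :=
  congrArg Neg.neg (type1Matrix_apply _ i j)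

theorem signInd_eq_one_or {G : Type} (X : Finset G) (x : G) :
    signInd X x = 1 ∨ signInd X x = -1 := by
  unfold signInd
  split_ifs <;> simp

theorem signInd_mul_self {G : Type} (X : Finset G) (x : G) :
    signInd X x * signInd X x = 1 := by
  rcases signInd_eq_one_or X x with h | h <;> simp [h]

theorem sum_signInd {G : Type} [Fintype G] (X : Finset G) :
    ∑ x, signInd X x = 2 * (X.card : ℝ) - Fintype.card G := by
  have h : ∀ x, signInd X x = 2 * (if x ∈ X then (1 : ℝ) else 0) - 1 := by
    intro x
    unfold signInd
    split_ifs <;> norm_num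
  simp [h, Finset.sum_sub_distrib, mul_comm]

theorem sum_signInd_mul_add {G : Type} [AddCommGroup G] [Fintype G] (X : Finset G)
    {g : G} (hg : g ≠ 0) :
    ∑ x, signInd X x * signInd X (x + g) = (Fintype.card G : ℝ) - 4 * X.card +
      4 * (((X ×ˢ X).filter (fun p => p.1 ≠ p.2 ∧ p.1 - p.2 = g)).card : ℝ) := by
  have hcard : ((X ×ˢ X).filter (fun p => p.1 ≠ p.2 ∧ p.1 - p.2 = g)).card =
      (Finset.univ.filter (fun x => x ∈ X ∧ x + g ∈ X)).card := by
    symm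
    refine Finset.card_bij (fun x _ => (x + g, x)) ?_ ?_ ?_
    · intro x hx
      simp_all
    · intro x _ y _ h
      exact (Prod.ext_iff.mp h).2
    · rintro ⟨a, b⟩ h
      simp only [Finset.mem_filter, Finset.mem_product] at h
      obtain ⟨⟨ha, hb⟩, -, rfl⟩ := h
      exact ⟨b, by simp [ha, hb], by simp⟩
  have h : ∀ x, signInd X x * signInd X (x + g) =
      4 * (if x ∈ X ∧ x + g ∈ X then (1 : ℝ) else 0) - signInd X x - signInd X (x + g) - 1 := by
    intro x
    unfold signInd
    by_cases h1 : x ∈ X <;> by_cases h2 : x + g ∈ X <;> norm_num [h1, h2]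
  have hshift : ∑ x, signInd X (x + g) = ∑ x, signInd X x :=
    Equiv.sum_comp (Equiv.addRight g) (signInd X)
  rw [hcard, Finset.sum_congr rfl fun x _ => h x]
  simp only [Finset.sum_sub_distrib, ← Finset.mul_sum, hshift, sum_signInd, Finset.sum_boole,
    Finset.sum_const, Finset.card_univ, nsmul_eq_mul, mul_one]
  ring

/-- **(Wallis–Street–Wallis.)**  If `{B₁, B₂}` is a difference family with
parameters `(2m+1, m, m-1)` in a finite abelian group `G` and `B₁` is skew,
then the array `H2` built from the type-1 matrix of `B₁` and the type-2 matrix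
of `B₂` is a skew Hadamard matrix of order `4(m+1)`. -/
theorem skew_hadamard_from_two_blocks
    (G : Type) [AddCommGroup G] [Fintype G] (m : ℕ)
    (hG : Fintype.card G = 2 * m + 1)
    (B₁ B₂ : Finset G) (hB₁ : B₁.card = m) (hB₂ : B₂.card = m)
    (hDF : ∀ g : G, g ≠ 0 →
      ((B₁ ×ˢ B₁).filter (fun p => p.1 ≠ p.2 ∧ p.1 - p.2 = g)).card +
      ((B₂ ×ˢ B₂).filter (fun p => p.1 ≠ p.2 ∧ p.1 - p.2 = g)).card = m - 1)
    (hskew : B₁ ∩ B₁.image (fun x => -x) = ∅ ∧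
      B₁ ∪ B₁.image (fun x => -x) = Finset.univ \ {0}) :
    Fintype.card (Fin 2 ⊕ (G ⊕ G)) = 4 * (m + 1) ∧
    (∀ i j, H2 G B₁ B₂ i j = 1 ∨ H2 G B₁ B₂ i j = -1) ∧
    H2 G B₁ B₂ * (H2 G B₁ B₂)ᵀ = ((4 * (m + 1) : ℕ) : ℝ) • 1 ∧
    (H2 G B₁ B₂ - 1)ᵀ = -(H2 G B₁ B₂ - 1) := by
  have hv : (Fintype.card G : ℝ) = 2 * m + 1 := by exact_mod_cast hG
  have s1 : ∑ x, signInd B₁ x = -1 := by rw [sum_signInd, hB₁, hv]; ring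
  have s2 : ∑ x, signInd B₂ x = -1 := by rw [sum_signInd, hB₂, hv]; ring
  have t1 : ∀ a, ∑ x, signInd B₁ (x - a) = -1 := fun a =>
    (Equiv.sum_comp (Equiv.subRight a) (signInd B₁)).trans s1
  have t2 : ∀ a, ∑ x, signInd B₂ (x + a) = -1 := fun a =>
    (Equiv.sum_comp (Equiv.addRight a) (signInd B₂)).trans s2
  have c1 : ∀ a b, ∑ x, signInd B₁ (x - a) * signInd B₁ (x - b) =
      ∑ x, signInd B₁ x * signInd B₁ (x + (a - b)) := by
    intro a b
    exact Fintype.sum_equiv (Equiv.subRight a) _ _ fun x => by simp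
  have c2 : ∀ a b, ∑ x, signInd B₂ (x + a) * signInd B₂ (x + b) =
      ∑ x, signInd B₂ x * signInd B₂ (x + (a - b)) := by
    intro a b
    refine Fintype.sum_equiv (Equiv.addRight b) _ _ fun x => ?_
    rw [mul_comm, Equiv.coe_addRight, show x + b + (a - b) = x + a by abel]
  have c12 : ∀ a b, ∑ x, signInd B₁ (x - a) * signInd B₂ (x + b) =
      ∑ x, signInd B₁ x * signInd B₂ (x + (a + b)) := by
    intro a b
    exact Fintype.sum_equiv (Equiv.subRight a) _ _ fun x => by simp [← add_assoc]
  have c21 : ∀ a b, ∑ x, signInd B₂ (x + a) * signInd B₁ (x - b) =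
      ∑ x, signInd B₁ (x - a) * signInd B₂ (x + b) := by
    intro a b
    rw [c12, add_comm a b, ← c12]
    exact Finset.sum_congr rfl fun x _ => mul_comm _ _
  have key : ∀ a b, ∑ x, signInd B₁ (x - a) * signInd B₁ (x - b) +
      ∑ x, signInd B₂ (x + a) * signInd B₂ (x + b) =
      if a = b then (4 * m + 2 : ℝ) else -2 := by
    intro a b
    split_ifs with hab
    · subst hab
      simp only [signInd_mul_self, Finset.sum_const, Finset.card_univ, nsmul_eq_mul, hv]
      ring
    · have hne : a - b ≠ 0 := sub_ne_zero.mpr hab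
      have hm : 1 ≤ m := by
        by_contra h0
        have : Fintype.card G ≤ 1 := by omega
        exact hab (Fintype.card_le_one_iff.mp this a b)
      have h := congrArg (Nat.cast : ℕ → ℝ) (hDF _ hne)
      rw [Nat.cast_add, Nat.cast_sub hm] at h
      rw [c1, c2, sum_signInd_mul_add _ hne, sum_signInd_mul_add _ hne, hB₁, hB₂, hv]
      push_cast at h
      linarith
  have hzero : (0 : G) ∉ B₁ := by
    intro h
    have : (0 : G) ∈ Finset.univ \ {0} := hskew.2 ▸ Finset.mem_union_left _ h
    simp at this
  have hneg : ∀ x, x ≠ 0 → signInd B₁ (-x) = -signInd B₁ x := by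
    intro x hx
    have hor : x ∈ B₁ ∨ -x ∈ B₁ := by
      have : x ∈ B₁ ∪ B₁.image (fun x => -x) := by rw [hskew.2]; simp [hx]
      simpa [neg_eq_iff_eq_neg] using this
    have hand : ¬ (x ∈ B₁ ∧ -x ∈ B₁) := by
      rintro ⟨h1, h2⟩
      have : x ∈ B₁ ∩ B₁.image (fun x => -x) := by simp [h1, h2, neg_eq_iff_eq_neg]
      simp [hskew.1] at this
    unfold signInd
    by_cases h1 : x ∈ B₁ <;> by_cases h2 : -x ∈ B₁ <;> simp_all
  refine ⟨?_, ?_, ?_, ?_⟩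
  · simp only [Fintype.card_sum, Fintype.card_fin, hG]
    ring
  · have h1 := signInd_eq_one_or B₁
    have h2 := signInd_eq_one_or B₂
    rintro (i | i | i) (j | j | j)
    · fin_cases i <;> fin_cases j <;> simp
    · simp
    · fin_cases i <;> simp
    · simp
    · simpa [neg_eq_iff_eq_neg, or_comm] using h1 (j - i)
    · simpa [neg_eq_iff_eq_neg, or_comm] using h2 (j + i)
    · fin_cases j <;> simp
    · simpa using h2 (j + i)
    · simpa [neg_eq_iff_eq_neg, or_comm] using h1 (j - i)
  · ext i j
    rw [Matrix.mul_apply, Fintype.sum_sum_type, Fintype.sum_sum_type, Fin.sum_univ_two]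
    rcases i with i | i | i <;> rcases j with j | j | j
    · fin_cases i <;> fin_cases j <;> simp [hv] <;> ring
    · fin_cases i <;> simp [t1, t2]
    · fin_cases i <;> simp [t1, t2]
    · fin_cases j <;> simp [t1, t2]
    · have := key i j
      simp [Matrix.one_apply]
      split_ifs at this ⊢ <;> linarith
    · have := c21 i j
      simp
      linarith
    · fin_cases j <;> simp [t1, t2]
    · have := c21 i j
      simp
      linarith
    · have := key i j
      simp [Matrix.one_apply]
      split_ifs at this ⊢ <;> linarith
  · have hM : ∀ i j : G, -signInd B₁ (i - j) - (1 : Matrix G G ℝ) j i =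
        signInd B₁ (j - i) + (1 : Matrix G G ℝ) i j := by
      intro i j
      by_cases hij : i = j
      · subst hij
        simp [signInd, hzero]
      · have := hneg (j - i) (sub_ne_zero.mpr (Ne.symm hij))
        rw [neg_sub] at this
        simp [this, hij, Ne.symm hij]
    ext i j
    rcases i with i | i | i <;> rcases j with j | j | j
    · fin_cases i <;> fin_cases j <;> simp
    · fin_cases i <;> simp
    · fin_cases i <;> simp
    · fin_cases j <;> simp
    · have := hM i j
      simp [Matrix.one_apply] at this ⊢
      linarith
    · simp [add_comm]
    · fin_cases j <;> simp
    · simp [add_comm]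
    · have := hM i j
      simp [Matrix.one_apply] at this ⊢
      linarith
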